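/- arXiv:1102.4838 — 2 statements merged into one kernel-verified Lean document; each statement's English description precedes it below -/
import Mathlib

section
/- Let ζ > 1, 0 < φ < π/2, a = sin φ, b = cos φ, and assume a·ζ < (1+b)/a. Then ∫_{x=(1+b)/a}^{ζ(1+b)/a} ∫_{y=(a·x·ζ−ζ²)/(x−a·ζ)}^{x·(1−b)/(1+b)} (x−y)^{−2} dy dx = ((1+b)/(2b))·log ζ − log ζ − (1/2)·log((1+b)²/a² − 2(1+b) + 1) + (1/2)·log((1+b)²/a² − 2(1+b)·ζ + ζ²). -/
open MeasureTheory intervalIntegral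

/-- The integral of `(x - y)⁻²` over an interval of values `y < x`. -/
theorem integral_inv_sub_sq {x u v : ℝ} (hu : u < x) (hv : v < x) :
    ∫ y in u..v, ((x - y) ^ 2)⁻¹ = (x - v)⁻¹ - (x - u)⁻¹ := by
  have hpos : ∀ y ∈ Set.uIcc u v, x - y ≠ 0 := fun y hy =>
    (sub_pos.2 (hy.2.trans_lt (max_lt hu hv))).ne'
  refine integral_eq_sub_of_hasDerivAt (f := fun y => (x - y)⁻¹) (fun y hy => ?_) ?_
  · exact (((hasDerivAt_id y).const_sub x).fun_inv (hpos y hy)).congr_deriv (by simp)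
  · refine ContinuousOn.intervalIntegrable (ContinuousOn.inv₀ (by fun_prop) fun y hy => ?_)
    exact pow_ne_zero 2 (hpos y hy)

/-- M₁: Let ζ > 1, 0 < φ < π/2, a = sin φ, b = cos φ, and assume a·ζ < (1+b)/a. Then
∫_{x=(1+b)/a}^{ζ(1+b)/a} ∫_{y=(a·x·ζ−ζ²)/(x−a·ζ)}^{x·(1−b)/(1+b)} (x−y)^{−2} dy dx
= ((1+b)/(2b))·log ζ − log ζ − (1/2)·log((1+b)²/a² − 2(1+b) + 1)
  + (1/2)·log((1+b)²/a² − 2(1+b)·ζ + ζ²). -/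
theorem stmt11 (ζ φ a b : ℝ) (hζ : 1 < ζ) (h1 : 0 < φ) (h2 : φ < Real.pi / 2)
    (ha : a = Real.sin φ) (hb : b = Real.cos φ) (hlt : a * ζ < (1 + b) / a) :
    ∫ x in ((1 + b) / a)..(ζ * (1 + b) / a),
      (∫ y in ((a * x * ζ - ζ ^ 2) / (x - a * ζ))..(x * (1 - b) / (1 + b)), ((x - y) ^ 2)⁻¹)
    = (1 + b) / (2 * b) * Real.log ζ - Real.log ζ
      - 1 / 2 * Real.log ((1 + b) ^ 2 / a ^ 2 - 2 * (1 + b) + 1)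
      + 1 / 2 * Real.log ((1 + b) ^ 2 / a ^ 2 - 2 * (1 + b) * ζ + ζ ^ 2) := by
  have hb0 : 0 < b := hb ▸ Real.cos_pos_of_mem_Ioo ⟨by linarith, h2⟩
  have ha0 : 0 < a := ha ▸ Real.sin_pos_of_pos_of_lt_pi h1 (by linarith [Real.pi_pos])
  have hab : a ^ 2 + b ^ 2 = 1 := by rw [ha, hb]; exact Real.sin_sq_add_cos_sq φ
  have hζ0 : 0 < ζ := by linarith
  have hζb : 0 < (b * ζ) ^ 2 := by positivity
  set c := (1 + b) / a with hc
  have hc0 : 0 < c := by positivity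
  have hac : a * c = 1 + b := by rw [hc]; field_simp
  have hcζ : c ≤ ζ * c := le_mul_of_one_le_left hc0.le hζ.le
  have hQ : ∀ x, 0 < x ^ 2 - 2 * a * ζ * x + ζ ^ 2 := fun x => by
    have : x ^ 2 - 2 * a * ζ * x + ζ ^ 2 = (x - a * ζ) ^ 2 + (b * ζ) ^ 2 := by
      linear_combination (-ζ ^ 2) * hab
    rw [this]; positivity
  rw [mul_div_assoc, ← hc, ← div_pow, ← hc]
  have hinner : ∀ x ∈ Set.uIcc c (ζ * c),
      (∫ y in ((a * x * ζ - ζ ^ 2) / (x - a * ζ))..(x * (1 - b) / (1 + b)), ((x - y) ^ 2)⁻¹)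
        = (1 + b) / (2 * b) * x⁻¹ - (x - a * ζ) / (x ^ 2 - 2 * a * ζ * x + ζ ^ 2) := by
    intro x hx
    rw [Set.uIcc_of_le hcζ] at hx
    have hx0 : 0 < x := hc0.trans_le hx.1
    have hxa : 0 < x - a * ζ := by linarith [hx.1]
    have hu : x - (a * x * ζ - ζ ^ 2) / (x - a * ζ)
        = (x ^ 2 - 2 * a * ζ * x + ζ ^ 2) / (x - a * ζ) := by
      field_simp; ring
    have hv : x - x * (1 - b) / (1 + b) = 2 * b * x / (1 + b) := by
      field_simp; ring
    rw [integral_inv_sub_sq (sub_pos.1 (hu ▸ div_pos (hQ x) hxa))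
      (sub_pos.1 (hv ▸ (by positivity))), hu, hv, inv_div, inv_div]
    congr 1
    field_simp
  rw [integral_congr hinner]
  have hderiv : ∀ x ∈ Set.uIcc c (ζ * c), HasDerivAt
      (fun x => (1 + b) / (2 * b) * Real.log x - 1 / 2 * Real.log (x ^ 2 - 2 * a * ζ * x + ζ ^ 2))
      ((1 + b) / (2 * b) * x⁻¹ - (x - a * ζ) / (x ^ 2 - 2 * a * ζ * x + ζ ^ 2)) x := by
    intro x hx
    rw [Set.uIcc_of_le hcζ] at hx
    have hx0 : x ≠ 0 := (hc0.trans_le hx.1).ne'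
    have hq : HasDerivAt (fun x => x ^ 2 - 2 * a * ζ * x + ζ ^ 2) (2 * x - 2 * a * ζ) x := by
      simpa using (((hasDerivAt_id x).pow 2).sub
        ((hasDerivAt_id x).const_mul (2 * a * ζ))).add_const (ζ ^ 2)
    refine (((Real.hasDerivAt_log hx0).const_mul ((1 + b) / (2 * b))).sub
      ((hq.log (hQ x).ne').const_mul (1 / 2))).congr_deriv ?_
    ring
  have hcont : ContinuousOn (fun x => (1 + b) / (2 * b) * x⁻¹
      - (x - a * ζ) / (x ^ 2 - 2 * a * ζ * x + ζ ^ 2)) (Set.uIcc c (ζ * c)) := by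
    rw [Set.uIcc_of_le hcζ]
    refine (continuousOn_const.mul (continuousOn_id.inv₀ fun x hx => (hc0.trans_le hx.1).ne')).sub
      (ContinuousOn.div (by fun_prop) (by fun_prop) fun x _ => (hQ x).ne')
  rw [integral_eq_sub_of_hasDerivAt hderiv hcont.intervalIntegrable]
  have hupper : (ζ * c) ^ 2 - 2 * a * ζ * (ζ * c) + ζ ^ 2
      = ζ ^ 2 * (c ^ 2 - 2 * (1 + b) + 1) := by
    linear_combination (-2 * ζ ^ 2) * hac
  have hlower : c ^ 2 - 2 * a * ζ * c + ζ ^ 2 = c ^ 2 - 2 * (1 + b) * ζ + ζ ^ 2 := by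
    linear_combination (-2 * ζ) * hac
  have hne : c ^ 2 - 2 * (1 + b) + 1 ≠ 0 := fun h => by
    have := hQ (ζ * c)
    rw [hupper, h, mul_zero] at this
    exact this.false
  simp only [hupper, hlower]
  rw [Real.log_mul hζ0.ne' hc0.ne', Real.log_mul (pow_ne_zero 2 hζ0.ne') hne, Real.log_pow]
  push_cast
  ring
end

section
/- Let ζ > 1, 0 < φ < π/2, and a = sin φ. Then ∫_{x=a}^{a·ζ} ∫_{y=−∞}^{(a·x−1)/(x−a)} (x−y)^{−2} dy dx = (1/2)·log(a²ζ² − 2a²ζ + 1) − (1/2)·log(1 − a²). -/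
open MeasureTheory intervalIntegral

/-- The tail integral `∫_{-∞}^c (x - y)⁻² dy` for `c < x`. -/
theorem integral_Iic_inv_sub_sq {x c : ℝ} (h : c < x) :
    ∫ y in Set.Iic c, ((x - y) ^ 2)⁻¹ = (x - c)⁻¹ := by
  have h_ioi : ∫ t in Set.Ioi (x - c), t ^ (-2 : ℝ) = (x - c)⁻¹ := by
    rw [integral_Ioi_rpow_of_lt (by norm_num) (sub_pos.2 h)]
    norm_num [Real.rpow_neg_one]
  have h_shift := (Measure.measurePreserving_sub_left (volume : Measure ℝ) x).setIntegral_preimage_emb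
    (MeasurableEquiv.subLeft x).measurableEmbedding (fun t : ℝ => t ^ (-2 : ℝ)) (Set.Ioi (x - c))
  rw [← h_ioi, ← h_shift, Set.preimage_const_sub_Ioi, sub_sub_cancel, integral_Iic_eq_integral_Iio]
  refine setIntegral_congr_fun measurableSet_Iio fun y hy => ?_
  have hy' : 0 ≤ x - y := by linarith [Set.mem_Iio.1 hy]
  simp [Real.rpow_neg hy']

/-- M₃: Let ζ > 1, 0 < φ < π/2, and a = sin φ. Then
∫_{x=a}^{a·ζ} ∫_{y=−∞}^{(a·x−1)/(x−a)} (x−y)^{−2} dy dx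
= (1/2)·log(a²ζ² − 2a²ζ + 1) − (1/2)·log(1 − a²). -/
theorem stmt13 (ζ φ a : ℝ) (hζ : 1 < ζ) (h1 : 0 < φ) (h2 : φ < Real.pi / 2)
    (ha : a = Real.sin φ) :
    ∫ x in a..(a * ζ), (∫ y in Set.Iic ((a * x - 1) / (x - a)), ((x - y) ^ 2)⁻¹)
    = 1 / 2 * Real.log (a ^ 2 * ζ ^ 2 - 2 * a ^ 2 * ζ + 1)
      - 1 / 2 * Real.log (1 - a ^ 2) := by
  have ha0 : 0 < a := ha ▸ Real.sin_pos_of_pos_of_lt_pi h1 (by linarith [Real.pi_pos])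
  have ha1 : a ^ 2 < 1 := by
    have hcos : 0 < Real.cos φ := Real.cos_pos_of_mem_Ioo ⟨by linarith, h2⟩
    rw [ha]
    nlinarith [Real.sin_sq_add_cos_sq φ]
  have haζ : a ≤ a * ζ := le_mul_of_one_le_right ha0.le hζ.le
  have hpos (x : ℝ) : 0 < x ^ 2 - 2 * a * x + 1 := by nlinarith [sq_nonneg (x - a)]
  have h_inner : ∫ x in a..(a * ζ), (∫ y in Set.Iic ((a * x - 1) / (x - a)), ((x - y) ^ 2)⁻¹)
      = ∫ x in a..(a * ζ), (x - a) / (x ^ 2 - 2 * a * x + 1) := by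
    rw [integral_of_le haζ, integral_of_le haζ]
    refine setIntegral_congr_fun measurableSet_Ioc fun x hx => ?_
    have hxa : 0 < x - a := sub_pos.2 hx.1
    have h_diff : x - (a * x - 1) / (x - a) = (x ^ 2 - 2 * a * x + 1) / (x - a) := by
      field_simp
      ring
    have h_lt : (a * x - 1) / (x - a) < x := sub_pos.1 (h_diff ▸ div_pos (hpos x) hxa)
    simp only [integral_Iic_inv_sub_sq h_lt, h_diff, inv_div]
  have h_deriv (x : ℝ) : HasDerivAt (fun x => 1 / 2 * Real.log (x ^ 2 - 2 * a * x + 1))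
      ((x - a) / (x ^ 2 - 2 * a * x + 1)) x := by
    have h_quad : HasDerivAt (fun x : ℝ => x ^ 2 - 2 * a * x + 1) (2 * x - 2 * a) x := by
      simpa using (((hasDerivAt_id x).pow 2).sub ((hasDerivAt_id x).const_mul (2 * a))).add_const 1
    exact ((h_quad.log (hpos x).ne').const_mul (1 / 2)).congr_deriv (by ring)
  have h_cont : Continuous fun x : ℝ => (x - a) / (x ^ 2 - 2 * a * x + 1) :=
    Continuous.div (by fun_prop) (by fun_prop) fun x => (hpos x).ne'
  rw [h_inner, integral_eq_sub_of_hasDerivAt (fun x _ => h_deriv x)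
    (h_cont.intervalIntegrable _ _)]
  have h_right : (a * ζ) ^ 2 - 2 * a * (a * ζ) + 1 = a ^ 2 * ζ ^ 2 - 2 * a ^ 2 * ζ + 1 := by ring
  have h_left : a ^ 2 - 2 * a * a + 1 = 1 - a ^ 2 := by ring
  simp only [h_right, h_left]
end
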